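/- arXiv:1502.00326 — 2 statements merged into one kernel-verified Lean document; each statement's English description precedes it below -/
import Mathlib

section
/- For all integers S ≥ 1, n ≥ 1 and all H > 0, the minimax risks under the Poissonized and Multinomial models satisfy R_P(S, 2n, H) − e^{−n/4}·H² ≤ R(S, n, H) ≤ 2·R_P(S, n/2, H). -/
open scoped BigOperators ENNReal

/-- Shannon entropy of a vector `p : Fin S → ℝ` (with the convention `0 ln 0 = 0`,
which holds automatically since `Real.log 0 = 0`). -/
noncomputable def entropy {S : ℕ} (p : Fin S → ℝ) : ℝ := ∑ i, -(p i * Real.log (p i))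

/-- `p` is a discrete probability distribution on `S` symbols. -/
def IsDist {S : ℕ} (p : Fin S → ℝ) : Prop := (∀ i, 0 ≤ p i) ∧ ∑ i, p i = 1

/-- Probability of observing the i.i.d. sample sequence `x` under `p`. -/
noncomputable def multProb {S n : ℕ} (p : Fin S → ℝ) (x : Fin n → Fin S) : ℝ :=
  ∏ j, p (x j)

/-- Squared L2 risk of an estimator `est` (a function of the `n` i.i.d. samples) at `p`. -/
noncomputable def estRisk (S n : ℕ) (est : (Fin n → Fin S) → ℝ) (p : Fin S → ℝ) : ℝ≥0∞ :=
  ∑ x : Fin n → Fin S,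
    ENNReal.ofReal (multProb p x) * ENNReal.ofReal ((est x - entropy p) ^ 2)

/-- Minimax squared L2 risk for entropy estimation over
`M_S(H) = {p : IsDist p, entropy p ≤ H}` from `n` i.i.d. samples. -/
noncomputable def minimaxRisk (S n : ℕ) (H : ℝ) : ℝ≥0∞ :=
  ⨅ est : (Fin n → Fin S) → ℝ,
    ⨆ p : {p : Fin S → ℝ // IsDist p ∧ entropy p ≤ H}, estRisk S n est p.1

/-- Poisson probability mass `e^{-λ} λ^k / k!` (for a real rate `λ`). -/
noncomputable def poissonP (lam : ℝ) (k : ℕ) : ℝ :=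
  Real.exp (-lam) * lam ^ k / (Nat.factorial k)

/-- Squared L2 risk of an estimator `est` under the Poissonized model, where one observes
`Z = (Z_1, …, Z_S)` with independent `Z_i ∼ Poisson(nr * p_i)`. -/
noncomputable def poisEstRisk (S : ℕ) (nr : ℝ) (est : (Fin S → ℕ) → ℝ) (p : Fin S → ℝ) :
    ℝ≥0∞ :=
  ∑' z : Fin S → ℕ,
    ENNReal.ofReal (∏ i, poissonP (nr * p i) (z i)) * ENNReal.ofReal ((est z - entropy p) ^ 2)

/-- Minimax squared L2 risk for entropy estimation under the Poissonized model with
(real) sample-size parameter `nr`. -/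
noncomputable def poisMinimaxRisk (S : ℕ) (nr : ℝ) (H : ℝ) : ℝ≥0∞ :=
  ⨅ est : (Fin S → ℕ) → ℝ,
    ⨆ p : {p : Fin S → ℝ // IsDist p ∧ entropy p ≤ H}, poisEstRisk S nr est p.1

/-- The histogram of a finite sequence of symbols. -/
def histogram {S m : ℕ} (x : Fin m → Fin S) (i : Fin S) : ℕ :=
  (Finset.univ.filter fun j => x j = i).card

theorem sum_histogram {S m : ℕ} (x : Fin m → Fin S) : ∑ i, histogram x i = m := by
  have h := Finset.card_eq_sum_card_fiberwise (s := Finset.univ) (t := Finset.univ) (f := x)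
    (fun _ _ => Finset.mem_coe.2 (Finset.mem_univ _))
  simpa [histogram] using h.symm

theorem prod_comp_eq_prod_pow_histogram {R : Type*} [CommMonoid R] {S m : ℕ} (p : Fin S → R)
    (x : Fin m → Fin S) : ∏ j, p (x j) = ∏ i, p i ^ histogram x i := by
  rw [← Finset.prod_fiberwise' Finset.univ x p]
  simp [histogram]

/-- The number of sequences with a prescribed histogram is a multinomial coefficient. -/
theorem card_filter_histogram_eq {S m : ℕ} (z : Fin S → ℕ) (hz : ∑ i, z i = m) :
    (Finset.univ.filter fun x : Fin m → Fin S => histogram x = z).card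
      = Nat.multinomial Finset.univ z := by
  let toFin : (Fin S → ℕ) → (Fin S →₀ ℕ) := Finsupp.equivFunOnFinite.symm
  have hinj : Function.Injective toFin := Finsupp.equivFunOnFinite.symm.injective
  have hmon : ∀ k : Fin S → ℕ, (∏ i, (MvPolynomial.X i : MvPolynomial (Fin S) ℕ) ^ k i)
      = MvPolynomial.monomial (toFin k) 1 := by
    intro k
    rw [MvPolynomial.monomial_eq, Finsupp.prod_fintype _ _ (fun _ => pow_zero _)]
    simp [toFin]
  have h1 : (∑ i, (MvPolynomial.X i : MvPolynomial (Fin S) ℕ)) ^ m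
      = ∑ x : Fin m → Fin S, MvPolynomial.monomial (toFin (histogram x)) 1 := by
    rw [Fintype.sum_pow]
    exact Finset.sum_congr rfl fun x _ => by rw [prod_comp_eq_prod_pow_histogram, hmon]
  have h2 := Finset.sum_pow_eq_sum_piAntidiag Finset.univ
    (fun i => (MvPolynomial.X i : MvPolynomial (Fin S) ℕ)) m
  rw [h1] at h2
  have h3 := congrArg (MvPolynomial.coeff (toFin z)) h2
  simp only [MvPolynomial.coeff_sum, MvPolynomial.coeff_monomial, hmon, hinj.eq_iff] at h3
  rw [Finset.card_filter, h3]
  rw [Finset.sum_eq_single z]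
  · rw [← map_natCast (MvPolynomial.C : ℕ →+* MvPolynomial (Fin S) ℕ),
      MvPolynomial.coeff_C_mul, MvPolynomial.coeff_monomial]
    simp
  · intro k _ hk
    rw [← map_natCast (MvPolynomial.C : ℕ →+* MvPolynomial (Fin S) ℕ),
      MvPolynomial.coeff_C_mul, MvPolynomial.coeff_monomial, if_neg (hinj.ne hk), mul_zero]
  · intro h
    exact absurd (by simp [hz]) h

theorem poissonP_nonneg {lam : ℝ} (h : 0 ≤ lam) (k : ℕ) : 0 ≤ poissonP lam k := by
  unfold poissonP; positivity

theorem hasSum_poissonP {lam : ℝ} (h : 0 ≤ lam) : HasSum (poissonP lam) 1 := by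
  lift lam to NNReal using h
  exact ProbabilityTheory.hasSum_one_poissonMeasure lam

theorem tsum_ofReal_poissonP {lam : ℝ} (h : 0 ≤ lam) :
    ∑' k, ENNReal.ofReal (poissonP lam k) = 1 := by
  rw [← ENNReal.ofReal_tsum_of_nonneg (poissonP_nonneg h) (hasSum_poissonP h).summable,
    (hasSum_poissonP h).tsum_eq, ENNReal.ofReal_one]

theorem multProb_nonneg {S m : ℕ} {p : Fin S → ℝ} (hp : ∀ i, 0 ≤ p i) (x : Fin m → Fin S) :
    0 ≤ multProb p x :=
  Finset.prod_nonneg fun _ _ => hp _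

/-- Independent Poisson counts: a Poisson total together with a multinomial histogram. -/
theorem prod_poissonP_eq {S : ℕ} {p : Fin S → ℝ} (hp : ∑ i, p i = 1) (lam : ℝ) (z : Fin S → ℕ) :
    ∏ i, poissonP (lam * p i) (z i)
      = (Finset.univ.filter fun x : Fin (∑ i, z i) → Fin S => histogram x = z).card
        * (poissonP lam (∑ i, z i) * ∏ i, p i ^ z i) := by
  rw [card_filter_histogram_eq z rfl]
  unfold poissonP
  have hspec : (∏ i, ((z i).factorial : ℝ)) * (Nat.multinomial Finset.univ z : ℝ)
      = ((∑ i, z i).factorial : ℝ) := by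
    exact_mod_cast Nat.multinomial_spec Finset.univ z
  rw [Finset.prod_div_distrib, Finset.prod_mul_distrib, ← Real.exp_sum]
  simp only [mul_pow]
  rw [Finset.prod_mul_distrib, Finset.prod_pow_eq_pow_sum, Finset.sum_neg_distrib,
    ← Finset.mul_sum, hp, mul_one, ← hspec]
  have h1 : (∏ i, ((z i).factorial : ℝ)) ≠ 0 :=
    Finset.prod_ne_zero_iff.2 fun i _ => by positivity
  have h2 : (Nat.multinomial Finset.univ z : ℝ) ≠ 0 := by
    exact_mod_cast (Nat.multinomial_pos Finset.univ z).ne'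
  field_simp

/-- Group all finite sequences by their histogram. -/
theorem tsum_sum_eq_tsum_histogram {S : ℕ} (G : ∀ m, (Fin m → Fin S) → ℝ≥0∞) :
    ∑' m, ∑ x, G m x
      = ∑' z : Fin S → ℕ,
          ∑ x ∈ Finset.univ.filter (fun x : Fin (∑ i, z i) → Fin S => histogram x = z),
            G (∑ i, z i) x := by
  have h : ∀ m, ∑ x, G m x
      = ∑' z : Fin S → ℕ, ∑ x ∈ Finset.univ.filter (fun x => histogram x = z), G m x := by
    intro m
    simp only [Finset.sum_filter]
    rw [Summable.tsum_finsetSum fun _ _ => ENNReal.summable]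
    refine Finset.sum_congr rfl fun x _ => ?_
    rw [tsum_eq_single (histogram x) fun z hz => if_neg hz.symm, if_pos rfl]
  simp_rw [h]
  rw [ENNReal.tsum_comm]
  refine tsum_congr fun z => tsum_eq_single _ fun m hm => ?_
  rw [Finset.filter_false_of_mem, Finset.sum_empty]
  rintro x - rfl
  exact hm (sum_histogram x).symm

theorem multProb_eq_of_histogram_eq {S m : ℕ} (p : Fin S → ℝ) {z : Fin S → ℕ}
    {x : Fin m → Fin S} (hx : histogram x = z) : multProb p x = ∏ i, p i ^ z i := by
  rw [multProb, prod_comp_eq_prod_pow_histogram, hx]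

theorem tsum_prod_poissonP_mul {S : ℕ} {p : Fin S → ℝ} (hp : IsDist p) {lam : ℝ} (hl : 0 ≤ lam)
    (g : (Fin S → ℕ) → ℝ≥0∞) :
    ∑' z : Fin S → ℕ, ENNReal.ofReal (∏ i, poissonP (lam * p i) (z i)) * g z
      = ∑' m, ENNReal.ofReal (poissonP lam m)
          * ∑ x : Fin m → Fin S, ENNReal.ofReal (multProb p x) * g (histogram x) := by
  simp_rw [Finset.mul_sum]
  rw [tsum_sum_eq_tsum_histogram]
  refine tsum_congr fun z => ?_
  rw [Finset.sum_congr rfl (g := fun _ => ENNReal.ofReal (poissonP lam (∑ i, z i)) *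
    (ENNReal.ofReal (∏ i, p i ^ z i) * g z)), Finset.sum_const, prod_poissonP_eq hp.2,
    ENNReal.ofReal_mul (Nat.cast_nonneg _), ENNReal.ofReal_mul (poissonP_nonneg hl _),
    ENNReal.ofReal_natCast, nsmul_eq_mul]
  · ring
  · intro x hx
    have hxz := (Finset.mem_filter.1 hx).2
    rw [multProb_eq_of_histogram_eq p hxz, hxz]

theorem sum_multProb {S m : ℕ} {p : Fin S → ℝ} (hp : IsDist p) :
    ∑ x : Fin m → Fin S, ENNReal.ofReal (multProb p x) = 1 := by
  rw [← ENNReal.ofReal_sum_of_nonneg fun x _ => multProb_nonneg hp.1 x]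
  simp only [multProb]
  rw [← Fintype.sum_pow, hp.2, one_pow, ENNReal.ofReal_one]

/-- The law of the first `k` samples does not depend on the later ones. -/
theorem sum_multProb_castLE {S k m : ℕ} {p : Fin S → ℝ} (hp : IsDist p) (hkm : k ≤ m)
    (f : (Fin k → Fin S) → ℝ≥0∞) :
    ∑ x : Fin m → Fin S, ENNReal.ofReal (multProb p x) * f (x ∘ Fin.castLE hkm)
      = ∑ y : Fin k → Fin S, ENNReal.ofReal (multProb p y) * f y := by
  obtain ⟨l, rfl⟩ := Nat.exists_eq_add_of_le hkm
  rw [← (Fin.appendEquiv k l).sum_comp, Fintype.sum_prod_type]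
  refine Finset.sum_congr rfl fun y _ => ?_
  have h : ∀ w : Fin l → Fin S,
      ENNReal.ofReal (multProb p (Fin.appendEquiv k l (y, w)))
          * f (Fin.appendEquiv k l (y, w) ∘ Fin.castLE hkm)
        = ENNReal.ofReal (multProb p y) * f y * ENNReal.ofReal (multProb p w) := by
    intro w
    have h1 : Fin.appendEquiv k l (y, w) ∘ Fin.castLE hkm = y := by
      funext j
      exact Fin.append_left y w j
    have h2 : multProb p (Fin.appendEquiv k l (y, w)) = multProb p y * multProb p w := by
      simp [multProb, Fin.prod_univ_add, Fin.appendEquiv]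
    rw [h1, h2, ENNReal.ofReal_mul (multProb_nonneg hp.1 y)]
    ring
  simp_rw [h]
  rw [← Finset.mul_sum, sum_multProb hp, mul_one]

/-- Jensen's inequality for the squared error of an averaged estimator. -/
theorem ofReal_sq_sum_sub_le {ι : Type*} (s : Finset ι) (w a : ι → ℝ) (h : ℝ)
    (hw : ∀ i ∈ s, 0 ≤ w i) (hw1 : ∑ i ∈ s, w i = 1) :
    ENNReal.ofReal ((∑ i ∈ s, w i * a i - h) ^ 2)
      ≤ ∑ i ∈ s, ENNReal.ofReal (w i) * ENNReal.ofReal ((a i - h) ^ 2) := by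
  have hsum : ∑ i ∈ s, w i * a i - h = ∑ i ∈ s, w i * (a i - h) := by
    simp only [mul_sub, Finset.sum_sub_distrib, ← Finset.sum_mul, hw1, one_mul]
  rw [hsum, Finset.sum_congr rfl fun i hi => (ENNReal.ofReal_mul (hw i hi)).symm,
    ← ENNReal.ofReal_sum_of_nonneg fun i hi => mul_nonneg (hw i hi) (sq_nonneg _)]
  exact ENNReal.ofReal_le_ofReal
    (Real.pow_arith_mean_le_arith_mean_pow_of_even s w _ hw hw1 even_two)

theorem entropy_nonneg {S : ℕ} {p : Fin S → ℝ} (hp : IsDist p) : 0 ≤ entropy p := by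
  refine Finset.sum_nonneg fun i _ => neg_nonneg.2 ?_
  refine mul_nonpos_of_nonneg_of_nonpos (hp.1 i) (Real.log_nonpos (hp.1 i) ?_)
  exact hp.2 ▸ Finset.single_le_sum (fun j _ => hp.1 j) (Finset.mem_univ i)

/-- A Poisson variable of mean `n / 2` is at most `n` with probability at least `1 / 2`. -/
theorem half_le_sum_poissonP (n : ℕ) :
    1 / 2 ≤ ∑ m ∈ Finset.range (n + 1), poissonP ((n : ℝ) / 2) m := by
  have hl : (0 : ℝ) ≤ (n : ℝ) / 2 := by positivity
  set q := poissonP ((n : ℝ) / 2) with hq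
  have hq0 : ∀ m, 0 ≤ q m := poissonP_nonneg hl
  have hsum : HasSum q 1 := hasSum_poissonP hl
  have hstep : ∀ m : ℕ, ((m + 1 : ℕ) : ℝ) * q (m + 1) = (n : ℝ) / 2 * q m := by
    intro m
    simp only [hq, poissonP, Nat.factorial_succ, Nat.cast_mul, pow_succ]
    field_simp
  have hmean : HasSum (fun m : ℕ => (m : ℝ) * q m) ((n : ℝ) / 2) := by
    rw [← hasSum_nat_add_iff' 1]
    simpa only [hstep, Finset.sum_range_one, Nat.cast_zero, zero_mul, sub_zero, mul_one]
      using hsum.mul_left ((n : ℝ) / 2)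
  have hfin := hasSum_sum_of_ne_finset_zero
    (f := fun m => if m ∈ Finset.range (n + 1) then q m else 0) (s := Finset.range (n + 1))
    (L := SummationFilter.unconditional ℕ) (fun m hm => if_neg hm)
  have hle := hasSum_le (fun m => ?_) hsum
    (hfin.add (hmean.div_const ((n : ℝ) + 1)))
  · rw [Finset.sum_congr rfl fun m hm => if_pos hm] at hle
    have : (n : ℝ) / 2 / (n + 1) ≤ 1 / 2 := by
      rw [div_le_div_iff₀ (by positivity) (by norm_num)]; linarith
    linarith
  · have hn : (0 : ℝ) < (n : ℝ) + 1 := by positivity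
    by_cases hm : m ∈ Finset.range (n + 1)
    · simp only [if_pos hm]
      have : 0 ≤ (m : ℝ) * q m / (n + 1) := div_nonneg (mul_nonneg (by positivity) (hq0 m)) hn.le
      linarith
    · simp only [if_neg hm, zero_add]
      rw [le_div_iff₀ hn, mul_comm]
      refine mul_le_mul_of_nonneg_right ?_ (hq0 m)
      rw [Finset.mem_range, not_lt] at hm
      exact_mod_cast hm

/-- A Chernoff bound for the lower tail of a Poisson variable of mean `2 n`. -/
theorem sum_poissonP_two_mul_le (n : ℕ) :
    ∑ m ∈ Finset.range n, poissonP (2 * (n : ℝ)) m ≤ Real.exp (-(n : ℝ) / 4) := by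
  have hterm : ∀ m ∈ Finset.range n,
      poissonP (2 * (n : ℝ)) m ≤ 2 ^ n * Real.exp (-(n : ℝ)) * poissonP n m := by
    intro m hm
    have h2 : (2 : ℝ) ^ m ≤ 2 ^ n :=
      pow_le_pow_right₀ (by norm_num) (Finset.mem_range.1 hm).le
    have he : Real.exp (-(2 * (n : ℝ))) = Real.exp (-(n : ℝ)) * Real.exp (-(n : ℝ)) := by
      rw [← Real.exp_add]; congr 1; ring
    have : poissonP (2 * (n : ℝ)) m = 2 ^ m * (Real.exp (-(n : ℝ)) * poissonP n m) := by
      simp only [poissonP, mul_pow, he]; ring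
    rw [this, mul_assoc]
    exact mul_le_mul_of_nonneg_right h2
      (mul_nonneg (Real.exp_pos _).le (poissonP_nonneg (Nat.cast_nonneg n) m))
  have hsum : ∑ m ∈ Finset.range n, poissonP n m ≤ 1 :=
    sum_le_hasSum _ (fun m _ => poissonP_nonneg (Nat.cast_nonneg n) m)
      (hasSum_poissonP (Nat.cast_nonneg n))
  calc ∑ m ∈ Finset.range n, poissonP (2 * (n : ℝ)) m
      ≤ 2 ^ n * Real.exp (-(n : ℝ)) * ∑ m ∈ Finset.range n, poissonP n m := by
        rw [Finset.mul_sum]; exact Finset.sum_le_sum hterm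
    _ ≤ 2 ^ n * Real.exp (-(n : ℝ)) := mul_le_of_le_one_right (by positivity) hsum
    _ = Real.exp (n * Real.log 2 - n) := by
        rw [sub_eq_add_neg, Real.exp_add, Real.exp_nat_mul, Real.exp_log (by norm_num)]
    _ ≤ Real.exp (-(n : ℝ) / 4) := by
        refine Real.exp_le_exp.2 ?_
        have := mul_le_mul_of_nonneg_left Real.log_two_lt_d9.le (Nat.cast_nonneg (α := ℝ) n)
        have hn : (0 : ℝ) ≤ n := Nat.cast_nonneg n
        linarith

/-- Truncate a Poissonized estimator to a multinomial one by averaging over a Poisson sample size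
conditioned to be at most `n`. -/
noncomputable def truncatedEstimator (S n : ℕ) (est : (Fin S → ℕ) → ℝ) (x : Fin n → Fin S) : ℝ :=
  ∑ m : Fin (n + 1), poissonP ((n : ℝ) / 2) m
    / (∑ k ∈ Finset.range (n + 1), poissonP ((n : ℝ) / 2) k)
    * est (histogram (x ∘ Fin.castLE (Nat.lt_succ_iff.1 m.2)))

theorem estRisk_truncatedEstimator_le {S n : ℕ} {p : Fin S → ℝ} (hp : IsDist p)
    (est : (Fin S → ℕ) → ℝ) :
    estRisk S n (truncatedEstimator S n est) p ≤ 2 * poisEstRisk S ((n : ℝ) / 2) est p := by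
  have hl : (0 : ℝ) ≤ (n : ℝ) / 2 := by positivity
  set q := poissonP ((n : ℝ) / 2) with hq
  set W := ∑ k ∈ Finset.range (n + 1), q k with hW
  have hq0 : ∀ m, 0 ≤ q m := poissonP_nonneg hl
  have hWhalf : 1 / 2 ≤ W := half_le_sum_poissonP n
  have hWpos : 0 < W := by linarith
  have hw1 : ∑ m : Fin (n + 1), q m / W = 1 := by
    rw [← Finset.sum_div, Fin.sum_univ_eq_sum_range, ← hW, div_self hWpos.ne']
  let R : ℕ → ℝ≥0∞ := fun m => ∑ y : Fin m → Fin S,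
    ENNReal.ofReal (multProb p y) * ENNReal.ofReal ((est (histogram y) - entropy p) ^ 2)
  calc estRisk S n (truncatedEstimator S n est) p
      ≤ ∑ x : Fin n → Fin S, ENNReal.ofReal (multProb p x) * ∑ m : Fin (n + 1),
          ENNReal.ofReal (q m / W) * ENNReal.ofReal
            ((est (histogram (x ∘ Fin.castLE (Nat.lt_succ_iff.1 m.2))) - entropy p) ^ 2) := by
        refine Finset.sum_le_sum fun x _ => ?_
        gcongr
        exact ofReal_sq_sum_sub_le Finset.univ (fun m : Fin (n + 1) => q m / W) _ _
          (fun m _ => div_nonneg (hq0 m) hWpos.le) hw1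
    _ = ∑ m : Fin (n + 1), ENNReal.ofReal (q m / W) * R m := by
        simp_rw [Finset.mul_sum]
        rw [Finset.sum_comm]
        refine Finset.sum_congr rfl fun m _ => ?_
        simp only [R]
        rw [← sum_multProb_castLE hp (Nat.lt_succ_iff.1 m.2)
          (fun y => ENNReal.ofReal ((est (histogram y) - entropy p) ^ 2)), Finset.mul_sum]
        exact Finset.sum_congr rfl fun x _ => mul_left_comm _ _ _
    _ ≤ ∑ m : Fin (n + 1), 2 * (ENNReal.ofReal (q m) * R m) := by
        refine Finset.sum_le_sum fun m _ => ?_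
        rw [← mul_assoc]
        gcongr
        rw [← ENNReal.ofReal_ofNat 2, ← ENNReal.ofReal_mul (by norm_num)]
        refine ENNReal.ofReal_le_ofReal ?_
        rw [div_le_iff₀ hWpos]
        nlinarith [hq0 m]
    _ = 2 * ∑ m ∈ Finset.range (n + 1), ENNReal.ofReal (q m) * R m := by
        rw [← Finset.mul_sum, Fin.sum_univ_eq_sum_range (fun m => ENNReal.ofReal (q m) * R m)]
    _ ≤ 2 * poisEstRisk S ((n : ℝ) / 2) est p := by
        gcongr
        rw [poisEstRisk, tsum_prod_poissonP_mul hp hl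
          (fun z => ENNReal.ofReal ((est z - entropy p) ^ 2))]
        exact ENNReal.sum_le_tsum _

/-- Apply a multinomial estimator to the first `n` of the `m` samples, and answer `0` when fewer
than `n` samples are available. -/
noncomputable def firstSamplesEstimator {S n : ℕ} (est : (Fin n → Fin S) → ℝ) {m : ℕ}
    (x : Fin m → Fin S) : ℝ :=
  if h : n ≤ m then est (x ∘ Fin.castLE h) else 0

/-- The Poissonized estimator averaging `firstSamplesEstimator` over all orderings of the sample. -/
noncomputable def symmetrizedEstimator {S n : ℕ} (est : (Fin n → Fin S) → ℝ)
    (z : Fin S → ℕ) : ℝ :=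
  ∑ x ∈ Finset.univ.filter (fun x : Fin (∑ i, z i) → Fin S => histogram x = z),
    ((Finset.univ.filter (fun x : Fin (∑ i, z i) → Fin S => histogram x = z)).card : ℝ)⁻¹
      * firstSamplesEstimator est x

theorem poisEstRisk_symmetrizedEstimator_le_tsum {S n : ℕ} {p : Fin S → ℝ} (hp : IsDist p)
    {lam : ℝ} (hl : 0 ≤ lam) (est : (Fin n → Fin S) → ℝ) :
    poisEstRisk S lam (symmetrizedEstimator est) p
      ≤ ∑' m, ENNReal.ofReal (poissonP lam m) * ∑ x : Fin m → Fin S,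
          ENNReal.ofReal (multProb p x)
            * ENNReal.ofReal ((firstSamplesEstimator est x - entropy p) ^ 2) := by
  simp_rw [Finset.mul_sum]
  rw [tsum_sum_eq_tsum_histogram, poisEstRisk]
  refine ENNReal.tsum_le_tsum fun z => ?_
  set A := Finset.univ.filter (fun x : Fin (∑ i, z i) → Fin S => histogram x = z) with hA
  have hc : (0 : ℝ) < (A.card : ℝ) := by
    rw [hA, card_filter_histogram_eq z rfl]
    exact_mod_cast Nat.multinomial_pos Finset.univ z
  have hj := ofReal_sq_sum_sub_le A (fun _ => (A.card : ℝ)⁻¹) (fun x => firstSamplesEstimator est x)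
    (entropy p) (fun _ _ => inv_nonneg.2 hc.le) (by
      rw [Finset.sum_const, nsmul_eq_mul, mul_inv_cancel₀ hc.ne'])
  refine (mul_le_mul_right hj _).trans_eq ?_
  rw [Finset.mul_sum]
  refine Finset.sum_congr rfl fun x hx => ?_
  rw [multProb_eq_of_histogram_eq p (Finset.mem_filter.1 hx).2, ← mul_assoc, ← mul_assoc,
    prod_poissonP_eq hp.2, ← hA,
    ← ENNReal.ofReal_mul (mul_nonneg hc.le (mul_nonneg (poissonP_nonneg hl _)
      (Finset.prod_nonneg fun i _ => pow_nonneg (hp.1 i) _))),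
    ← ENNReal.ofReal_mul (poissonP_nonneg hl _)]
  congr 2
  field_simp

theorem poisEstRisk_symmetrizedEstimator_le {S n : ℕ} {p : Fin S → ℝ} (hp : IsDist p) {H : ℝ}
    (hH : entropy p ≤ H) (est : (Fin n → Fin S) → ℝ) :
    poisEstRisk S (2 * (n : ℝ)) (symmetrizedEstimator est) p
      ≤ estRisk S n est p + ENNReal.ofReal (Real.exp (-(n : ℝ) / 4) * H ^ 2) := by
  have hl : (0 : ℝ) ≤ 2 * (n : ℝ) := by positivity
  set q := poissonP (2 * (n : ℝ)) with hq
  have hq0 : ∀ m, 0 ≤ q m := poissonP_nonneg hl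
  refine (poisEstRisk_symmetrizedEstimator_le_tsum hp hl est).trans ?_
  have hterm : ∀ m, ENNReal.ofReal (q m) * ∑ x : Fin m → Fin S, ENNReal.ofReal (multProb p x)
        * ENNReal.ofReal ((firstSamplesEstimator est x - entropy p) ^ 2)
      ≤ ENNReal.ofReal (q m) * estRisk S n est p
        + if m ∈ Finset.range n then ENNReal.ofReal (q m) * ENNReal.ofReal (H ^ 2) else 0 := by
    intro m
    by_cases h : n ≤ m
    · refine le_add_right (mul_le_mul_right (le_of_eq ?_) _)
      simp only [firstSamplesEstimator, dif_pos h]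
      exact sum_multProb_castLE hp h (fun y => ENNReal.ofReal ((est y - entropy p) ^ 2))
    · rw [if_pos (Finset.mem_range.2 (not_le.1 h))]
      refine le_add_left (mul_le_mul_right ?_ _)
      simp only [firstSamplesEstimator, dif_neg h]
      rw [← Finset.sum_mul, sum_multProb hp, one_mul, zero_sub, neg_sq]
      exact ENNReal.ofReal_le_ofReal (pow_le_pow_left₀ (entropy_nonneg hp) hH 2)
  refine (ENNReal.tsum_le_tsum hterm).trans ?_
  rw [ENNReal.tsum_add, ENNReal.tsum_mul_right, tsum_ofReal_poissonP hl, one_mul,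
    tsum_eq_sum (s := Finset.range n) fun m hm => if_neg hm,
    Finset.sum_congr rfl fun m hm => if_pos hm, ← Finset.sum_mul,
    ← ENNReal.ofReal_sum_of_nonneg fun m _ => hq0 m,
    ← ENNReal.ofReal_mul (Finset.sum_nonneg fun m _ => hq0 m)]
  gcongr
  exact sum_poissonP_two_mul_le n

theorem poissonized_multinomial_equivalence :
    ∀ (S n : ℕ), 1 ≤ S → 1 ≤ n → ∀ H : ℝ, 0 < H →
      poisMinimaxRisk S (2 * (n : ℝ)) H - ENNReal.ofReal (Real.exp (-(n : ℝ) / 4) * H ^ 2)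
          ≤ minimaxRisk S n H ∧
        minimaxRisk S n H ≤ 2 * poisMinimaxRisk S ((n : ℝ) / 2) H := by
  intro S n _ _ H _
  constructor
  · rw [tsub_le_iff_right, minimaxRisk, ENNReal.iInf_add]
    refine le_iInf fun est => iInf_le_of_le (symmetrizedEstimator est) (iSup_le fun p => ?_)
    refine (poisEstRisk_symmetrizedEstimator_le p.2.1 p.2.2 est).trans ?_
    gcongr
    exact le_iSup (fun p : {p : Fin S → ℝ // IsDist p ∧ entropy p ≤ H} => estRisk S n est p.1) p
  · rw [poisMinimaxRisk, ENNReal.mul_iInf_of_ne two_ne_zero ENNReal.ofNat_ne_top]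
    refine le_iInf fun est => iInf_le_of_le (truncatedEstimator S n est) (iSup_le fun p => ?_)
    refine (estRisk_truncatedEstimator_le p.2.1 est).trans ?_
    gcongr
    exact le_iSup (fun p : {p : Fin S → ℝ // IsDist p ∧ entropy p ≤ H} =>
      poisEstRisk S ((n : ℝ) / 2) est p.1) p
end

section
/- There exists a universal constant D_n > 0 such that for every positive integer K ≥ 1 the following holds: if ∑_{k=0}^K g_{K,k} x^k is the degree-K polynomial of best uniform approximation to −x ln x on [0,1] and p_K(x) = ∑_{k=1}^K g_{K,k} x^k is this polynomial with its constant term removed, then sup_{x∈[0,1]} |p_K(x) − (−x ln x)| ≤ D_n / K². -/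
/-- The uniform (sup-norm) error of approximating `f` by the polynomial `q` on `[a,b]`. -/
noncomputable def uniformErr (f : ℝ → ℝ) (a b : ℝ) (q : Polynomial ℝ) : ℝ :=
  sSup ((fun x => |f x - q.eval x|) '' Set.Icc a b)

/-- `q` is a polynomial of best uniform approximation of degree at most `K` to `f` on `[a,b]`. -/
def IsBestApprox (K : ℕ) (f : ℝ → ℝ) (a b : ℝ) (q : Polynomial ℝ) : Prop :=
  q.natDegree ≤ K ∧ ∀ r : Polynomial ℝ, r.natDegree ≤ K → uniformErr f a b q ≤ uniformErr f a b r

open Filter Topology Polynomial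

/-- The coefficients of the power series of `-(1 - z) log (1 - z) / z`. -/
noncomputable def oneSubMulLogCoeff (n : ℕ) : ℝ := 1 / (n + 1) - 1 / n

lemma oneSubMulLogCoeff_of_pos {n : ℕ} (hn : 1 ≤ n) :
    oneSubMulLogCoeff n = -(1 / (n * (n + 1))) := by
  have : (n : ℝ) ≠ 0 := by positivity
  rw [oneSubMulLogCoeff]
  field_simp
  ring

lemma oneSubMulLogCoeff_nonpos {n : ℕ} (hn : 1 ≤ n) : oneSubMulLogCoeff n ≤ 0 := by
  rw [oneSubMulLogCoeff_of_pos hn]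
  exact neg_nonpos.2 (by positivity)

lemma oneSubMulLogCoeff_le_succ {n : ℕ} (hn : 1 ≤ n) :
    oneSubMulLogCoeff n ≤ oneSubMulLogCoeff (n + 1) := by
  rw [oneSubMulLogCoeff_of_pos hn, oneSubMulLogCoeff_of_pos (by lia)]
  push_cast
  gcongr <;> linarith

lemma abs_oneSubMulLogCoeff_le (n : ℕ) :
    |oneSubMulLogCoeff n| ≤ 2 * (1 / ((n + 1 : ℕ) : ℝ) ^ 2) := by
  rcases Nat.eq_zero_or_pos n with rfl | hn
  · norm_num [oneSubMulLogCoeff]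
  · have h1 : (1 : ℝ) ≤ n := by exact_mod_cast hn
    rw [abs_of_nonpos (oneSubMulLogCoeff_nonpos hn), oneSubMulLogCoeff_of_pos hn, neg_neg,
      mul_one_div, div_le_div_iff₀ (by positivity) (by positivity)]
    push_cast
    nlinarith

lemma summable_oneSubMulLogCoeff_mul_pow {z : ℂ} (hz : ‖z‖ = 1) :
    Summable fun n : ℕ => (oneSubMulLogCoeff n : ℂ) * z ^ (n + 1) := by
  have h : Summable fun n : ℕ => 2 * (1 / ((n + 1 : ℕ) : ℝ) ^ 2) :=
    ((summable_nat_add_iff 1).2 (Real.summable_one_div_nat_pow.2 one_lt_two)).mul_left 2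
  refine h.of_norm_bounded fun n => ?_
  simpa [hz] using abs_oneSubMulLogCoeff_le n

lemma hasSum_oneSubMulLogCoeff_of_norm_lt_one {w : ℂ} (hw : ‖w‖ < 1) :
    HasSum (fun n : ℕ => (oneSubMulLogCoeff n : ℂ) * w ^ (n + 1))
      (-((1 - w) * Complex.log (1 - w))) := by
  have h := Complex.hasSum_taylorSeries_neg_log hw
  have h1 : HasSum (fun n : ℕ => w ^ (n + 1) / ((n + 1 : ℕ) : ℂ)) (-Complex.log (1 - w)) :=
    (hasSum_nat_add_iff (f := fun n : ℕ => w ^ n / (n : ℂ)) 1).2 (by simpa using h)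
  rw [show -((1 - w) * Complex.log (1 - w)) =
    -Complex.log (1 - w) - w * -Complex.log (1 - w) by ring]
  have hterm (n : ℕ) : (oneSubMulLogCoeff n : ℂ) * w ^ (n + 1) =
      w ^ (n + 1) / ((n + 1 : ℕ) : ℂ) - w * (w ^ n / (n : ℂ)) := by
    rw [oneSubMulLogCoeff]
    push_cast
    ring
  simpa only [hterm] using h1.sub (h.mul_left w)

lemma hasSum_oneSubMulLogCoeff_of_norm_eq_one {z : ℂ} (hz : ‖z‖ = 1) (hz1 : z ≠ 1) :
    HasSum (fun n : ℕ => (oneSubMulLogCoeff n : ℂ) * z ^ (n + 1))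
      (-((1 - z) * Complex.log (1 - z))) := by
  have hs := (summable_oneSubMulLogCoeff_mul_pow hz).hasSum
  have hslit : 1 - z ∈ Complex.slitPlane := by
    have h1 : z.re < 1 := by
      refine lt_of_le_of_ne (hz ▸ Complex.re_le_norm z) fun h => hz1 ?_
      have h2 : z.re * z.re + z.im * z.im = 1 := by
        rw [← Complex.normSq_apply, Complex.normSq_eq_norm_sq, hz, one_pow]
      refine Complex.ext h ?_
      rw [h] at h2
      simpa using h2
    exact Or.inl (by simpa using h1)
  have hA := (tendsto_map'_iff.1
    (Complex.tendsto_tsum_powerSeries_nhdsWithin_lt hs.tendsto_sum_nat))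
  have hr : Tendsto (fun r : ℝ => (r : ℂ)) (𝓝[<] 1) (𝓝 1) := by
    simpa using (Complex.continuous_ofReal.tendsto 1).mono_left nhdsWithin_le_nhds
  have hw : Tendsto (fun r : ℝ => 1 - (r : ℂ) * z) (𝓝[<] 1) (𝓝 (1 - z)) := by
    simpa using tendsto_const_nhds.sub (hr.mul_const z)
  have hB := (hw.mul (hw.clog hslit)).neg
  have hC := hr.mul hA
  rw [one_mul] at hC
  have heq : (fun r : ℝ => -((1 - (r : ℂ) * z) * Complex.log (1 - (r : ℂ) * z))) =ᶠ[𝓝[<] 1]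
      fun r : ℝ => (r : ℂ) * ((fun w : ℂ =>
        ∑' n : ℕ, (oneSubMulLogCoeff n : ℂ) * z ^ (n + 1) * w ^ n) ∘ Complex.ofReal) r := by
    filter_upwards [Ioo_mem_nhdsLT (show (0 : ℝ) < 1 by norm_num)] with r hr
    have hlt : ‖(r : ℂ) * z‖ < 1 := by
      rw [norm_mul, hz, mul_one, Complex.norm_real, Real.norm_of_nonneg hr.1.le]
      exact hr.2
    rw [← (hasSum_oneSubMulLogCoeff_of_norm_lt_one hlt).tsum_eq, Function.comp_apply,
      ← tsum_mul_left]
    congr 1 with n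
    ring
  rw [tendsto_nhds_unique (hB.congr' heq) hC]
  exact hs

lemma hasSum_chebyshev_mul_log {x : ℝ} (hx0 : 0 < x) (hx1 : x ≤ 1) :
    HasSum (fun n : ℕ => oneSubMulLogCoeff n *
        ((Chebyshev.T ℝ ((n + 1 : ℕ) : ℤ)).eval (1 - 2 * x) -
          (Chebyshev.T ℝ (n : ℤ)).eval (1 - 2 * x)))
      (-(2 * x * (Real.log 4 + Real.log x))) := by
  obtain ⟨φ, hφ⟩ : ∃ φ : ℝ, Real.cos φ = 1 - 2 * x :=
    ⟨Real.arccos (1 - 2 * x), Real.cos_arccos (by linarith) (by linarith)⟩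
  set z : ℂ := Complex.exp (φ * Complex.I) with hz
  have hnorm : ‖z‖ = 1 := Complex.norm_exp_ofReal_mul_I φ
  have hre : z.re = 1 - 2 * x := by rw [hz, Complex.exp_ofReal_mul_I_re, hφ]
  have hne : z ≠ 1 := fun h => by
    rw [h, Complex.one_re] at hre
    linarith
  have hsq : Complex.normSq (1 - z) = 4 * x := by
    rw [Complex.normSq_sub, map_one, Complex.normSq_eq_norm_sq, hnorm, one_mul, Complex.conj_re,
      hre]
    ring
  have hmul : (1 - (starRingEnd ℂ) z) * z = z - 1 := by
    have : (starRingEnd ℂ) z * z = 1 := by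
      rw [← Complex.normSq_eq_conj_mul_self, Complex.normSq_eq_norm_sq, hnorm]
      simp
    rw [sub_mul, this, one_mul]
  have hpow (n : ℕ) : (z ^ n).re = (Chebyshev.T ℝ (n : ℤ)).eval (1 - 2 * x) := by
    rw [← hφ, Chebyshev.T_real_cos, hz, ← Complex.exp_nat_mul, ← Complex.exp_ofReal_mul_I_re]
    push_cast
    ring_nf
  convert Complex.hasSum_re ((hasSum_oneSubMulLogCoeff_of_norm_eq_one hnorm hne).mul_left
    (1 - (starRingEnd ℂ) z)) using 1
  · ext n
    rw [← hpow, ← hpow, ← Complex.sub_re, ← Complex.re_ofReal_mul]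
    congr 1
    linear_combination (-(oneSubMulLogCoeff n : ℂ) * z ^ n) * hmul
  · have h1 : (1 - (starRingEnd ℂ) z) * -((1 - z) * Complex.log (1 - z)) =
        ((-(4 * x) : ℝ) : ℂ) * Complex.log (1 - z) := by
      rw [← hsq, Complex.ofReal_neg, Complex.normSq_eq_conj_mul_self, map_sub, map_one]
      ring
    have h2 : 2 * Real.log ‖1 - z‖ = Real.log 4 + Real.log x := by
      rw [← Real.log_mul (by norm_num) hx0.ne', ← hsq, Complex.normSq_eq_norm_sq, Real.log_pow]
      norm_num
    rw [h1, Complex.re_ofReal_mul, Complex.log_re, ← h2]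
    ring

/-- Summation by parts for a nonpositive increasing weight `e` against the increments of a
sequence bounded by one. -/
lemma abs_sum_mul_increment_le {e t : ℕ → ℝ} (he : ∀ n, e n ≤ 0) (hmono : Monotone e)
    (ht : ∀ n, |t n| ≤ 1) (m : ℕ) :
    |∑ n ∈ Finset.range m, e n * (t (n + 1) - t n)| ≤ -(2 * e 0) := by
  have key : |∑ n ∈ Finset.range m, e n * (t (n + 1) - t n) - e m * t m| ≤ e m - 2 * e 0 := by
    induction m with
    | zero =>
      rw [Finset.sum_range_zero, zero_sub, abs_neg, abs_mul, abs_of_nonpos (he 0)]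
      nlinarith [he 0, ht 0]
    | succ m ih =>
      have h1 : |(e m - e (m + 1)) * t (m + 1)| ≤ e (m + 1) - e m := by
        have h2 := hmono (Nat.le_succ m)
        rw [abs_mul, abs_sub_comm, abs_of_nonneg (sub_nonneg.2 h2)]
        exact mul_le_of_le_one_right (sub_nonneg.2 h2) (ht _)
      calc _ = |(∑ n ∈ Finset.range m, e n * (t (n + 1) - t n) - e m * t m) +
            (e m - e (m + 1)) * t (m + 1)| := by
              rw [Finset.sum_range_succ]
              congr 1
              ring
        _ ≤ _ := (abs_add_le _ _).trans (by linarith)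
  have h3 : |e m * t m| ≤ -e m := by
    rw [abs_mul, abs_of_nonpos (he m)]
    exact mul_le_of_le_one_right (neg_nonneg.2 (he m)) (ht m)
  rw [abs_le] at *
  constructor <;> linarith

lemma exists_polynomial_abs_negMulLog_sub_le {K : ℕ} (hK : 1 ≤ K) :
    ∃ r : ℝ[X], r.natDegree ≤ K ∧
      ∀ x ∈ Set.Icc (0 : ℝ) 1, |-(x * Real.log x) - r.eval x| ≤ 1 / (K : ℝ) ^ 2 := by
  let L : ℝ[X] := 1 - C 2 * X
  have hL : L.natDegree ≤ 1 := by
    simp only [L]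
    compute_degree
  have hT (n : ℕ) (hn : n ≤ K) : ((Chebyshev.T ℝ (n : ℤ)).comp L).natDegree ≤ K := by
    refine natDegree_comp_le.trans ?_
    rw [Chebyshev.natDegree_T, Int.natAbs_natCast]
    nlinarith
  refine ⟨C (Real.log 4) * X + C (1 / 2) * ∑ n ∈ Finset.range K, C (oneSubMulLogCoeff n) *
    ((Chebyshev.T ℝ ((n + 1 : ℕ) : ℤ)).comp L - (Chebyshev.T ℝ (n : ℤ)).comp L), ?_, ?_⟩
  · refine natDegree_add_le_of_degree_le (((natDegree_C_mul_le _ _).trans natDegree_X_le).trans hK)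
      ((natDegree_C_mul_le _ _).trans (natDegree_sum_le_of_forall_le _ _ fun n hn => ?_))
    have hn := Finset.mem_range.1 hn
    exact (natDegree_C_mul_le _ _).trans
      ((natDegree_sub_le _ _).trans (max_le (hT _ hn) (hT _ hn.le)))
  · generalize hr : C (Real.log 4) * X + C (1 / 2) * _ = r
    have hclosed : IsClosed {x : ℝ | |-(x * Real.log x) - r.eval x| ≤ 1 / (K : ℝ) ^ 2} :=
      isClosed_le ((Real.continuous_mul_log.neg.sub r.continuous).abs) continuous_const
    have hsub : Set.Ioc (0 : ℝ) 1 ⊆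
        {x : ℝ | |-(x * Real.log x) - r.eval x| ≤ 1 / (K : ℝ) ^ 2} := by
      intro x hx
      let t : ℕ → ℝ := fun n => (Chebyshev.T ℝ (n : ℤ)).eval (1 - 2 * x)
      have htail := ((hasSum_nat_add_iff' K).2
        (hasSum_chebyshev_mul_log hx.1 hx.2)).tendsto_sum_nat
      have hle := le_of_tendsto' htail.abs fun m => by
        have := abs_sum_mul_increment_le (e := fun n => oneSubMulLogCoeff (n + K))
          (t := fun n => t (n + K)) (fun n => oneSubMulLogCoeff_nonpos (by lia))
          (monotone_nat_of_le_succ fun n => by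
            simpa [add_right_comm] using oneSubMulLogCoeff_le_succ (n := n + K) (by lia))
          (fun n => Chebyshev.abs_eval_T_real_le_one _
            (abs_le.2 ⟨by linarith [hx.2], by linarith [hx.1]⟩)) m
        simpa only [t, add_right_comm] using this
      have heval : r.eval x = Real.log 4 * x + 1 / 2 * ∑ n ∈ Finset.range K,
          oneSubMulLogCoeff n * (t (n + 1) - t n) := by
        simp [← hr, eval_finsetSum, L, t]
      have hcoeff : -oneSubMulLogCoeff K ≤ 1 / (K : ℝ) ^ 2 := by
        have : (0 : ℝ) < K := by exact_mod_cast hK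
        rw [oneSubMulLogCoeff_of_pos hK, neg_neg]
        apply one_div_le_one_div_of_le <;> nlinarith
      rw [Nat.zero_add] at hle
      change |-(2 * x * (Real.log 4 + Real.log x)) - ∑ n ∈ Finset.range K,
          oneSubMulLogCoeff n * (t (n + 1) - t n)| ≤ _ at hle
      rw [Set.mem_ofPred_eq, heval]
      rw [abs_le] at hle ⊢
      constructor <;> linarith
    intro x hx
    rw [← closure_Ioc (zero_ne_one' ℝ)] at hx
    exact closure_minimal hsub hclosed hx

lemma abs_sub_eval_le_uniformErr {f : ℝ → ℝ} {a b : ℝ} (hf : ContinuousOn f (Set.Icc a b))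
    (q : ℝ[X]) {x : ℝ} (hx : x ∈ Set.Icc a b) : |f x - q.eval x| ≤ uniformErr f a b q :=
  le_csSup (isCompact_Icc.image_of_continuousOn (hf.sub q.continuousOn).abs).bddAbove
    (Set.mem_image_of_mem _ hx)

theorem best_approx_without_constant_norm_bound :
    ∃ Dₙ : ℝ, 0 < Dₙ ∧
      ∀ K : ℕ, 1 ≤ K →
        ∀ q : Polynomial ℝ, IsBestApprox K (fun x => -(x * Real.log x)) 0 1 q →
          ∀ x ∈ Set.Icc (0 : ℝ) 1,
            |(q.eval x - q.coeff 0) - (-(x * Real.log x))| ≤ Dₙ / (K : ℝ) ^ 2 := by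
  refine ⟨2, two_pos, fun K hK q hq x hx => ?_⟩
  obtain ⟨r, hrdeg, hr⟩ := exists_polynomial_abs_negMulLog_sub_le hK
  have hbound : uniformErr (fun x => -(x * Real.log x)) 0 1 q ≤ 1 / (K : ℝ) ^ 2 := by
    refine (hq.2 r hrdeg).trans (csSup_le ((Set.nonempty_Icc.2 zero_le_one).image _) ?_)
    rintro _ ⟨y, hy, rfl⟩
    exact hr y hy
  have herr {y : ℝ} (hy : y ∈ Set.Icc (0 : ℝ) 1) :
      |-(y * Real.log y) - q.eval y| ≤ 1 / (K : ℝ) ^ 2 :=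
    (abs_sub_eval_le_uniformErr Real.continuous_mul_log.neg.continuousOn q hy).trans hbound
  have h0 := herr (Set.left_mem_Icc.2 zero_le_one)
  rw [zero_mul, neg_zero, zero_sub, ← coeff_zero_eq_eval_zero] at h0
  have h1 := herr hx
  have h2 : (2 : ℝ) / (K : ℝ) ^ 2 = 1 / (K : ℝ) ^ 2 + 1 / (K : ℝ) ^ 2 := by ring
  rw [h2]
  rw [abs_le] at *
  constructor <;> linarith
end
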